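/- arXiv:2604.21145 — 2 statements merged into one kernel-verified Lean document; each statement's English description precedes it below -/
import Mathlib

section
/- Let m>1 and suppose q ≥ m (region G₂, p∈ℝ arbitrary). Then for every ε>0 there exists an edge weight μ on the homogeneous tree T_N and a nonconstant positive function u on T_N such that W_o(n) ≍ n^{m}·(ln n)^{m−1+ε} for all n ≥ 2, and u satisfies Δ_m u(x) + u(x)^p·|∇u(x)|^q ≤ 0 at every vertex x of T_N; i.e., (★) admits a nontrivial positive solution on (T_N, μ). -/
variable {V : Type*}

/-- Vertex measure `μ(x) = ∑_{y} μ_{xy}` of a weighted graph. -/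
noncomputable def vMeasure (μ : V → V → ℝ) (x : V) : ℝ := ∑ᶠ y, μ x y

/-- The `m`-Laplacian on a weighted graph. -/
noncomputable def lapM (μ : V → V → ℝ) (m : ℝ) (u : V → ℝ) (x : V) : ℝ :=
  (vMeasure μ x)⁻¹ * ∑ᶠ y, μ x y * |u y - u x| ^ (m - 2) * (u y - u x)

/-- The norm of the gradient on a weighted graph. -/
noncomputable def gradNorm (μ : V → V → ℝ) (u : V → ℝ) (x : V) : ℝ :=
  Real.sqrt (∑ᶠ y, μ x y / (2 * vMeasure μ x) * (u y - u x) ^ 2)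

open Classical in
/-- `W_o(n)`: the sum of `μ_{xy}` over pairs `(x,y)` with `x ∈ B(o,n)`, `y ∈ V`
and `d(o,x) < d(o,y)`. -/
noncomputable def Wvol (G : SimpleGraph V) (μ : V → V → ℝ) (o : V) (n : ℕ) : ℝ :=
  ∑ᶠ x, ∑ᶠ y, if G.dist o x ≤ n ∧ G.dist o x < G.dist o y then μ x y else 0

namespace TreeAux

theorem parent_exists {V : Type*} {G : SimpleGraph V} (htree : G.IsTree) (o x : V) (k : ℕ)
    (hx : G.dist o x = k + 1) : ∃ y, G.Adj x y ∧ G.dist o y = k := by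
  obtain ⟨p, hp, hl⟩ := htree.connected.exists_path_of_dist o x
  have hnil : ¬ p.Nil := by
    intro h
    have := SimpleGraph.Walk.length_eq_zero_iff.mpr h
    omega
  refine ⟨p.penultimate, (p.adj_penultimate hnil).symm, ?_⟩
  have h1 : G.dist o p.penultimate ≤ p.dropLast.length := SimpleGraph.dist_le _
  have h2 : p.dropLast.length + 1 = p.length := SimpleGraph.Walk.length_dropLast_add_one hnil
  rcases htree.dist_eq_dist_add_one_of_adj o (p.adj_penultimate hnil) with h | h <;> omega

theorem parent_unique {V : Type*} {G : SimpleGraph V} (htree : G.IsTree) (o x : V) (k : ℕ)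
    (hx : G.dist o x = k + 1) (y z : V) (hy : G.Adj x y) (hyk : G.dist o y = k)
    (hz : G.Adj x z) (hzk : G.dist o z = k) : y = z := by
  obtain ⟨p, hp, hl⟩ := htree.connected.exists_path_of_dist o y
  obtain ⟨r, hr, hl'⟩ := htree.connected.exists_path_of_dist o z
  have h1 : (p.concat hy.symm).IsPath := SimpleGraph.Walk.isPath_of_length_eq_dist _ (by
    rw [SimpleGraph.Walk.length_concat]; omega)
  have h2 : (r.concat hz.symm).IsPath := SimpleGraph.Walk.isPath_of_length_eq_dist _ (by
    rw [SimpleGraph.Walk.length_concat]; omega)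
  have h3 := (htree.existsUnique_path o x).unique h1 h2
  have h4 := congrArg SimpleGraph.Walk.penultimate h3
  simpa using h4

theorem nbr_fin {V : Type*} {G : SimpleGraph V} {N : ℕ} (hN : 2 ≤ N)
    (hreg : ∀ v, (G.neighborSet v).ncard = N) (x : V) : (G.neighborSet x).Finite :=
  Set.finite_of_ncard_pos (by rw [hreg]; omega)

theorem sum_root {V : Type*} {G : SimpleGraph V} {N : ℕ} (hN : 2 ≤ N)
    (hreg : ∀ v, (G.neighborSet v).ncard = N) (o : V) (F : V → ℝ) (B : ℝ)
    (hB : ∀ y, G.Adj o y → G.dist o y = 1 → F y = B) (h0 : ∀ y, ¬ G.Adj o y → F y = 0) :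
    ∑ᶠ y, F y = N * B := by
  classical
  have hf := nbr_fin hN hreg o
  rw [finsum_eq_sum_of_support_subset F (s := hf.toFinset)]
  · rw [Finset.sum_congr rfl (g := fun _ => B)]
    · rw [Finset.sum_const, nsmul_eq_mul, ← Set.ncard_eq_toFinset_card _ hf, hreg]
    · intro y hy
      have : G.Adj o y := by simpa using hy
      exact hB y this (SimpleGraph.dist_eq_one_iff_adj.mpr this)
  · intro y hy
    by_contra h
    exact hy (h0 y (by simpa using h))

theorem sum_succ {V : Type*} {G : SimpleGraph V} {N : ℕ} (hN : 2 ≤ N) (htree : G.IsTree)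
    (hreg : ∀ v, (G.neighborSet v).ncard = N) (o x : V) (k : ℕ) (hx : G.dist o x = k + 1)
    (F : V → ℝ) (A B : ℝ)
    (hA : ∀ y, G.Adj x y → G.dist o y = k → F y = A)
    (hB : ∀ y, G.Adj x y → G.dist o y = k + 2 → F y = B) (h0 : ∀ y, ¬ G.Adj x y → F y = 0) :
    ∑ᶠ y, F y = A + ((N : ℝ) - 1) * B := by
  classical
  have hf := nbr_fin hN hreg x
  obtain ⟨z, hz, hzk⟩ := parent_exists htree o x k hx
  have hzm : z ∈ hf.toFinset := by simpa using hz
  rw [finsum_eq_sum_of_support_subset F (s := hf.toFinset)]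
  · rw [← Finset.add_sum_erase _ _ hzm, hA z hz hzk, Finset.sum_congr rfl (g := fun _ => B)]
    · rw [Finset.sum_const, nsmul_eq_mul, Finset.card_erase_of_mem hzm,
        ← Set.ncard_eq_toFinset_card _ hf, hreg]
      push_cast [Nat.cast_sub (show 1 ≤ N by omega)]
      rfl
    · intro y hy
      have hy1 : G.Adj x y := by simpa using Finset.mem_of_mem_erase hy
      have hy2 := Finset.ne_of_mem_erase hy
      refine hB y hy1 ?_
      rcases htree.dist_eq_dist_add_one_of_adj o hy1 with h | h
      · exact absurd (parent_unique htree o x k hx y z hy1 (by omega) hz hzk) hy2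
      · omega
  · intro y hy
    by_contra h
    exact hy (h0 y (by simpa using h))

theorem spheres {V : Type*} {G : SimpleGraph V} {N : ℕ} (hN : 2 ≤ N) (htree : G.IsTree)
    (hreg : ∀ v, (G.neighborSet v).ncard = N) (o : V) (k : ℕ) :
    ∃ S : Finset V, (∀ x, x ∈ S ↔ G.dist o x = k) ∧
      (S.card : ℝ) * (if k = 0 then (N : ℝ) else (N : ℝ) - 1) = N * ((N : ℝ) - 1) ^ k := by
  classical
  induction k with
  | zero =>
    refine ⟨{o}, fun x => ?_, by simp⟩
    rw [htree.connected.dist_eq_zero_iff]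
    simp [eq_comm]
  | succ k ih =>
    obtain ⟨S, hS, hc⟩ := ih
    let ch : V → Finset V := fun x => (nbr_fin hN hreg x).toFinset.filter (fun y => G.dist o y = k + 1)
    have hch : ∀ x y, y ∈ ch x ↔ G.Adj x y ∧ G.dist o y = k + 1 := by
      intro x y; simp [ch]
    refine ⟨S.biUnion ch, fun x => ?_, ?_⟩
    · simp only [Finset.mem_biUnion, hch, hS]
      constructor
      · rintro ⟨_, _, _, h⟩; exact h
      · intro h
        obtain ⟨y, hy, hyk⟩ := parent_exists htree o x k h
        exact ⟨y, hyk, hy.symm, h⟩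
    · rw [Finset.card_biUnion]
      · have : ∀ x ∈ S, (((ch x).card : ℕ) : ℝ) = (if k = 0 then (N : ℝ) else (N : ℝ) - 1) := by
          intro x hx
          have hxk := (hS x).mp hx
          have hsum : (((ch x).card : ℕ) : ℝ) = ∑ᶠ y, if y ∈ ch x then (1 : ℝ) else 0 := by
            rw [finsum_eq_sum_of_support_subset (s := ch x)]
            · simp
            · intro y hy; by_contra h; simp at h; simp [h] at hy
          rw [hsum]
          by_cases hk : k = 0
          · subst hk
            have hox : o = x := htree.connected.dist_eq_zero_iff.mp hxk
            subst hox
            rw [sum_root hN hreg o _ 1]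
            · simp
            · intro y hy hd; rw [if_pos]; rw [hch]; exact ⟨hy, hd⟩
            · intro y hy; rw [if_neg]; rw [hch]; tauto
          · obtain ⟨j, rfl⟩ := Nat.exists_eq_succ_of_ne_zero hk
            rw [sum_succ hN htree hreg o x j hxk _ 0 1]
            · simp
            · intro y hy hd; rw [if_neg]; rw [hch]; omega
            · intro y hy hd; rw [if_pos]; rw [hch]; exact ⟨hy, hd⟩
            · intro y hy; rw [if_neg]; rw [hch]; tauto
        push_cast
        rw [Finset.sum_congr rfl this, Finset.sum_const, nsmul_eq_mul, hc]
        simp [pow_succ]; ring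
      · intro x hx z hz hxz
        change Disjoint (ch x) (ch z)
        rw [Finset.disjoint_left]
        intro y hy hy'
        rw [hch] at hy hy'
        exact hxz (parent_unique htree o y k hy.2 x z hy.1.symm ((hS x).mp hx) hy'.1.symm
          ((hS z).mp hz))

open Classical in
/-- Radial edge weight. -/
noncomputable def radW {V : Type*} (G : SimpleGraph V) (o : V) (N : ℕ) (w : ℕ → ℝ) (x y : V) : ℝ :=
  if G.Adj x y then w (min (G.dist o x) (G.dist o y)) /
    ((N : ℝ) - 1) ^ (min (G.dist o x) (G.dist o y)) else 0

theorem radW_symm {V : Type*} (G : SimpleGraph V) (o : V) (N : ℕ) (w : ℕ → ℝ) (x y : V) :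
    radW G o N w x y = radW G o N w y x := by
  unfold radW
  rw [G.adj_comm, min_comm]

theorem radW_non {V : Type*} (G : SimpleGraph V) (o : V) (N : ℕ) (w : ℕ → ℝ) (x y : V)
    (h : ¬ G.Adj x y) : radW G o N w x y = 0 := by
  unfold radW
  rw [if_neg h]

theorem radW_adj {V : Type*} (G : SimpleGraph V) (o : V) (N : ℕ) (w : ℕ → ℝ) (x y : V) (k : ℕ)
    (h : G.Adj x y) (hk : min (G.dist o x) (G.dist o y) = k) :
    radW G o N w x y = w k / ((N : ℝ) - 1) ^ k := by
  unfold radW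
  rw [if_pos h, hk]

theorem radW_pos {V : Type*} (G : SimpleGraph V) (o : V) {N : ℕ} (hN : 2 ≤ N) (w : ℕ → ℝ)
    (hw : ∀ k, 0 < w k) (x y : V) : 0 < radW G o N w x y ↔ G.Adj x y := by
  have hN' : (0 : ℝ) < (N : ℝ) - 1 := by
    have : (2 : ℝ) ≤ N := by exact_mod_cast hN
    linarith
  constructor
  · intro h
    by_contra h'
    rw [radW_non _ _ _ _ _ _ h'] at h
    exact lt_irrefl _ h
  · intro h
    rw [radW_adj G o N w x y _ h rfl]
    exact div_pos (hw _) (pow_pos hN' _)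

theorem wvol_eq {V : Type*} {G : SimpleGraph V} {N : ℕ} (hN : 2 ≤ N) (htree : G.IsTree)
    (hreg : ∀ v, (G.neighborSet v).ncard = N) (o : V) (w : ℕ → ℝ) (n : ℕ) :
    Wvol G (radW G o N w) o n = N * ∑ k ∈ Finset.range (n + 1), w k := by
  classical
  have hN' : (0 : ℝ) < (N : ℝ) - 1 := by
    have : (2 : ℝ) ≤ N := by exact_mod_cast hN
    linarith
  choose S hS hc using spheres hN htree hreg o
  unfold Wvol
  have inner : ∀ x, (∑ᶠ y, if G.dist o x ≤ n ∧ G.dist o x < G.dist o y then radW G o N w x y else 0)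
      = if G.dist o x ≤ n then (if G.dist o x = 0 then (N : ℝ) else (N : ℝ) - 1) *
        (w (G.dist o x) / ((N : ℝ) - 1) ^ (G.dist o x)) else 0 := by
    intro x
    by_cases hn : G.dist o x ≤ n
    · simp only [hn, true_and, if_true]
      rcases hk : G.dist o x with _ | k
      · have hox : o = x := htree.connected.dist_eq_zero_iff.mp hk
        subst hox
        rw [sum_root hN hreg o _ (w 0 / ((N : ℝ) - 1) ^ 0)]
        · simp
        · intro y hy hd
          rw [if_pos (by omega)]
          exact radW_adj _ _ _ _ _ _ _ hy (by omega)
        · intro y hy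
          rw [radW_non _ _ _ _ _ _ hy, ite_self]
      · rw [sum_succ hN htree hreg o x k hk _ 0 (w (k+1) / ((N : ℝ) - 1) ^ (k+1))]
        · simp
        · intro y hy hd
          rw [if_neg (by omega)]
        · intro y hy hd
          rw [if_pos (by omega)]
          exact radW_adj _ _ _ _ _ _ _ hy (by omega)
        · intro y hy
          rw [radW_non _ _ _ _ _ _ hy, ite_self]
    · simp [hn]
  rw [finsum_congr inner,
    finsum_eq_sum_of_support_subset (s := (Finset.range (n+1)).biUnion S)]
  · rw [Finset.sum_biUnion, Finset.mul_sum]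
    · refine Finset.sum_congr rfl fun k hk => ?_
      rw [Finset.sum_congr rfl (g := fun _ => (if k = 0 then (N : ℝ) else (N : ℝ) - 1) *
        (w k / ((N : ℝ) - 1) ^ k))]
      · rw [Finset.sum_const, nsmul_eq_mul, ← mul_assoc, hc]
        have := (pow_pos hN' k).ne'
        field_simp
      · intro x hx
        rw [hS] at hx
        rw [hx, if_pos (by simpa [Nat.lt_succ_iff] using hk)]
    · intro i _ j _ hij
      change Disjoint (S i) (S j)
      rw [Finset.disjoint_left]
      intro x hx hx'
      rw [hS] at hx hx'
      omega
  · intro x hx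
    simp only [Finset.coe_biUnion, Set.mem_iUnion, Finset.mem_coe, hS, Finset.mem_range]
    by_contra h
    apply hx
    refine if_neg ?_
    intro h'
    exact h ⟨G.dist o x, by omega, rfl⟩

theorem pow_aux (m a : ℝ) (ha : 0 < a) : a ^ (m - 2) * a = a ^ (m - 1) := by
  nth_rewrite 2 [← Real.rpow_one a]
  rw [← Real.rpow_add ha]; congr 1; ring

theorem vert_root {V : Type*} {G : SimpleGraph V} {N : ℕ} (hN : 2 ≤ N)
    (hreg : ∀ v, (G.neighborSet v).ncard = N) (o : V) (w f : ℕ → ℝ) (hw : ∀ k, 0 < w k)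
    (hf : ∀ k, f (k+1) < f k) (m : ℝ) :
    lapM (radW G o N w) m (fun x => f (G.dist o x)) o = - (f 0 - f 1) ^ (m - 1) ∧
    gradNorm (radW G o N w) (fun x => f (G.dist o x)) o ≤ f 0 - f 1 := by
  have hN' : (0 : ℝ) < (N : ℝ) := by
    have : (2 : ℝ) ≤ N := by exact_mod_cast hN
    linarith
  have hw0 := hw 0
  have ha : 0 < f 0 - f 1 := by have := hf 0; simp at this; linarith
  have hμ : ∀ y, G.Adj o y → G.dist o y = 1 → radW G o N w o y = w 0 := by
    intro y hy hd
    rw [radW_adj G o N w o y 0 hy (by simp)]; simp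
  have hv : vMeasure (radW G o N w) o = N * w 0 := by
    unfold vMeasure
    exact sum_root hN hreg o _ _ hμ fun y hy => radW_non _ _ _ _ _ _ hy
  constructor
  · unfold lapM
    rw [hv, sum_root hN hreg o _ (w 0 * -((f 0 - f 1) ^ (m - 1)))]
    · field_simp
    · intro y hy hd
      simp only [hd, hμ y hy hd, SimpleGraph.dist_self]
      rw [abs_sub_comm, abs_of_pos ha, ← pow_aux m _ ha]; ring
    · intro y hy
      rw [radW_non _ _ _ _ _ _ hy]; simp
  · unfold gradNorm
    rw [hv, sum_root hN hreg o _ (w 0 / (2 * (N * w 0)) * (f 0 - f 1) ^ 2)]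
    · apply Real.sqrt_le_iff.mpr ⟨ha.le, ?_⟩
      have : (N : ℝ) * (w 0 / (2 * (N * w 0)) * (f 0 - f 1) ^ 2) = (f 0 - f 1) ^ 2 / 2 := by
        field_simp
      rw [this]
      nlinarith [sq_nonneg (f 0 - f 1)]
    · intro y hy hd
      simp only [hd, hμ y hy hd, SimpleGraph.dist_self]
      ring
    · intro y hy
      rw [radW_non _ _ _ _ _ _ hy]; simp

theorem vert_succ {V : Type*} {G : SimpleGraph V} {N : ℕ} (hN : 2 ≤ N) (htree : G.IsTree)
    (hreg : ∀ v, (G.neighborSet v).ncard = N) (o : V) (w f : ℕ → ℝ) (hw : ∀ k, 0 < w k)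
    (hf : ∀ k, f (k+1) < f k) (m : ℝ) (x : V) (k : ℕ) (hx : G.dist o x = k + 1)
    (hanti : f (k+1) - f (k+2) ≤ f k - f (k+1)) :
    lapM (radW G o N w) m (fun x => f (G.dist o x)) x =
      (w k * (f k - f (k+1)) ^ (m - 1) - w (k+1) * (f (k+1) - f (k+2)) ^ (m - 1)) /
        (w k + w (k+1)) ∧
    gradNorm (radW G o N w) (fun x => f (G.dist o x)) x ≤ f k - f (k+1) := by
  have hN' : (0 : ℝ) < (N : ℝ) - 1 := by
    have : (2 : ℝ) ≤ N := by exact_mod_cast hN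
    linarith
  have hw0 := hw k
  have hw1 := hw (k+1)
  have ha : 0 < f k - f (k+1) := by have := hf k; linarith
  have hb : 0 < f (k+1) - f (k+2) := by have := hf (k+1); linarith
  set D := ((N : ℝ) - 1) with hD
  have hDk : 0 < D ^ k := pow_pos hN' k
  have hμ1 : ∀ y, G.Adj x y → G.dist o y = k → radW G o N w x y = w k / D ^ k := by
    intro y hy hd
    exact radW_adj G o N w x y k hy (by omega)
  have hμ2 : ∀ y, G.Adj x y → G.dist o y = k + 2 →
      radW G o N w x y = w (k+1) / (D ^ k * D) := by
    intro y hy hd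
    rw [← pow_succ]
    exact radW_adj G o N w x y (k+1) hy (by omega)
  have hv : vMeasure (radW G o N w) x = (w k + w (k+1)) / D ^ k := by
    unfold vMeasure
    rw [sum_succ hN htree hreg o x k hx _ _ _ hμ1 hμ2 fun y hy => radW_non _ _ _ _ _ _ hy, ← hD]
    field_simp
  have hs : 0 < w k + w (k+1) := by linarith
  constructor
  · unfold lapM
    rw [hv, sum_succ hN htree hreg o x k hx _ (w k / D ^ k * ((f k - f (k+1)) ^ (m - 1)))
      (w (k+1) / (D ^ k * D) * -((f (k+1) - f (k+2)) ^ (m - 1))), ← hD]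
    · field_simp
      ring
    · intro y hy hd
      simp only [hd, hμ1 y hy hd, hx]
      rw [abs_of_pos ha, ← pow_aux m _ ha]; ring
    · intro y hy hd
      simp only [hd, hμ2 y hy hd, hx]
      rw [abs_sub_comm, abs_of_pos hb, ← pow_aux m _ hb]; ring
    · intro y hy
      rw [radW_non _ _ _ _ _ _ hy]; simp
  · unfold gradNorm
    rw [hv, sum_succ hN htree hreg o x k hx _
      (w k / D ^ k / (2 * ((w k + w (k+1)) / D ^ k)) * (f k - f (k+1)) ^ 2)
      (w (k+1) / (D ^ k * D) / (2 * ((w k + w (k+1)) / D ^ k)) * (f (k+1) - f (k+2)) ^ 2), ← hD]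
    · apply Real.sqrt_le_iff.mpr ⟨ha.le, ?_⟩
      have : (w k / D ^ k / (2 * ((w k + w (k+1)) / D ^ k)) * (f k - f (k+1)) ^ 2) + D *
        (w (k+1) / (D ^ k * D) / (2 * ((w k + w (k+1)) / D ^ k)) * (f (k+1) - f (k+2)) ^ 2)
        = (w k * (f k - f (k+1)) ^ 2 + w (k+1) * (f (k+1) - f (k+2)) ^ 2) /
          (2 * (w k + w (k+1))) := by
        field_simp
      rw [this, div_le_iff₀ (by positivity)]
      have h2 : (f (k+1) - f (k+2)) ^ 2 ≤ (f k - f (k+1)) ^ 2 := by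
        apply pow_le_pow_left₀ hb.le hanti
      have h3 := mul_le_mul_of_nonneg_left h2 hw1.le
      have h4 : 0 ≤ (f k - f (k+1)) ^ 2 * (w k + w (k+1)) := by positivity
      nlinarith
    · intro y hy hd
      simp only [hd, hμ1 y hy hd, hx]
    · intro y hy hd
      simp only [hd, hμ2 y hy hd, hx]
      ring
    · intro y hy
      rw [radW_non _ _ _ _ _ _ hy]; simp

theorem abs_construct (m p q : ℝ) (hm : 1 < m) (hq : m ≤ q) (h : ℕ → ℝ) (hpos : ∀ k, 0 < h k)
    (hanti : ∀ k, h (k+1) ≤ h k) (R : ℝ) (hR : 0 < R) (hrat : ∀ k, h k ≤ R * h (k+1))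
    (B : ℝ) (hB : ∀ n, ∑ k ∈ Finset.range n, h k ≤ B) :
    ∃ w f : ℕ → ℝ, (∀ k, 0 < w k) ∧ (∀ k, 0 < f k) ∧ (∀ k, f (k+1) < f k) ∧
      (∀ k, f (k+1) - f (k+2) ≤ f k - f (k+1)) ∧
      (f 0 ^ p * (f 0 - f 1) ^ q ≤ (f 0 - f 1) ^ (m - 1)) ∧
      (∀ k, f (k+1) ^ p * (f k - f (k+1)) ^ q ≤
        (w (k+1) * (f (k+1) - f (k+2)) ^ (m - 1) - w k * (f k - f (k+1)) ^ (m - 1)) /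
        (w k + w (k+1))) ∧
      (∀ k, h k ^ (1 - m) ≤ w k) ∧ (∀ k, w k ≤ (1 + B) * h k ^ (1 - m)) := by
  set s : ℕ → ℝ := fun n => ∑ k ∈ Finset.range n, h k with hs
  have hs0 : ∀ n, 0 ≤ s n := fun n => Finset.sum_nonneg fun k _ => (hpos k).le
  have hss : ∀ n, s (n+1) = s n + h n := fun n => Finset.sum_range_succ _ _
  have hB0 : 0 ≤ B := by simpa using hB 0
  have hh0 : ∀ k, h k ≤ h 0 := fun k => antitone_nat_of_succ_le hanti (Nat.zero_le k)
  set K : ℝ := (1 + B) ^ |p| with hK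
  have hK1 : 0 < K := Real.rpow_pos_of_pos (by linarith) _
  set C : ℝ := K * (2 * (1 + B) * R ^ (m - 1)) with hC
  have hRm : 0 < R ^ (m - 1) := Real.rpow_pos_of_pos hR _
  have hC0 : 0 < C := by positivity
  have h00 := hpos 0
  set δ : ℝ := 1 / (C + h 0 + K * h 0 + 1) with hδ
  have hden : 0 < C + h 0 + K * h 0 + 1 := by positivity
  have hδ0 : 0 < δ := by positivity
  have hδ1 : δ ≤ 1 := by
    rw [hδ, div_le_one hden]; nlinarith [mul_pos hK1 h00]
  have hδC : C * δ ≤ 1 := by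
    rw [hδ, mul_one_div, div_le_one hden]; nlinarith [mul_pos hK1 h00]
  have hδh : δ * h 0 ≤ 1 := by
    rw [hδ, mul_comm, mul_one_div, div_le_one hden]; nlinarith [mul_pos hK1 h00]
  have hδK : K * (δ * h 0) ≤ 1 := by
    have : K * (δ * h 0) = (K * h 0) / (C + h 0 + K * h 0 + 1) := by rw [hδ]; ring
    rw [this, div_le_one hden]; nlinarith [mul_pos hK1 h00]
  set f : ℕ → ℝ := fun n => 1 + δ * (B - s n) with hf
  set w : ℕ → ℝ := fun n => (1 + s n) * h n ^ (1 - m) with hw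
  have hf1 : ∀ n, 1 ≤ f n := fun n => by
    have := mul_nonneg hδ0.le (sub_nonneg.mpr (hB n))
    simp only [hf]; linarith
  have hf2 : ∀ n, f n ≤ 1 + B := fun n => by
    have h1 : δ * (B - s n) ≤ 1 * (B - s n) :=
      mul_le_mul_of_nonneg_right hδ1 (sub_nonneg.mpr (hB n))
    have := hs0 n
    simp only [hf]; linarith
  have hfp : ∀ n, f n ^ p ≤ K := fun n => by
    calc f n ^ p ≤ f n ^ |p| := Real.rpow_le_rpow_of_exponent_le (hf1 n) (le_abs_self p)
      _ ≤ K := Real.rpow_le_rpow (by linarith [hf1 n]) (hf2 n) (abs_nonneg p)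
  have hd : ∀ k, f k - f (k+1) = δ * h k := fun k => by
    simp only [hf, hss]; ring
  have hd0 : f 0 - f 1 = δ * h 0 := hd 0
  have hd2 : ∀ k, f (k+1) - f (k+2) = δ * h (k+1) := fun k => hd (k+1)
  have hhm : ∀ k, 0 < h k ^ (1 - m) := fun k => Real.rpow_pos_of_pos (hpos k) _
  have hwpos : ∀ k, 0 < w k := fun k => mul_pos (by linarith [hs0 k]) (hhm k)
  have hwB : ∀ k, w k ≤ (1 + B) * h k ^ (1 - m) := fun k =>
    mul_le_mul_of_nonneg_right (by linarith [hB k]) (hhm k).le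
  have hflux : ∀ k, w k * (δ * h k) ^ (m - 1) = δ ^ (m - 1) * (1 + s k) := fun k => by
    have : h k ^ (1 - m) * h k ^ (m - 1) = 1 := by
      rw [← Real.rpow_add (hpos k)]; simp
    rw [Real.mul_rpow hδ0.le (hpos k).le]
    calc (1 + s k) * h k ^ (1 - m) * (δ ^ (m - 1) * h k ^ (m - 1))
        = δ ^ (m - 1) * (1 + s k) * (h k ^ (1 - m) * h k ^ (m - 1)) := by ring
      _ = _ := by rw [this]; ring
  have hpq : ∀ k, (δ * h k) ^ q ≤ (δ * h k) ^ (m - 1) * (δ * h k) := fun k => by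
    have hp0 : 0 < δ * h k := mul_pos hδ0 (hpos k)
    have hp1 : δ * h k ≤ 1 := (mul_le_mul_of_nonneg_left (hh0 k) hδ0.le).trans hδh
    have : (δ * h k) ^ (m - 1) * (δ * h k) = (δ * h k) ^ m := by
      nth_rewrite 2 [← Real.rpow_one (δ * h k)]
      rw [← Real.rpow_add hp0]; congr 1; ring
    rw [this]
    exact Real.rpow_le_rpow_of_exponent_ge hp0 hp1 hq
  refine ⟨w, f, hwpos, fun k => by linarith [hf1 k], fun k => ?_, fun k => ?_, ?_, fun k => ?_,
    fun k => ?_, hwB⟩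
  · have := hd k
    have := mul_pos hδ0 (hpos k)
    linarith
  · rw [hd k, hd2 k]
    exact mul_le_mul_of_nonneg_left (hanti k) hδ0.le
  · rw [hd0]
    have hp0 : 0 < δ * h 0 := mul_pos hδ0 h00
    have hpm : 0 < (δ * h 0) ^ (m - 1) := Real.rpow_pos_of_pos hp0 _
    calc f 0 ^ p * (δ * h 0) ^ q ≤ K * ((δ * h 0) ^ (m - 1) * (δ * h 0)) :=
          mul_le_mul (hfp 0) (hpq 0) (Real.rpow_pos_of_pos hp0 _).le hK1.le
      _ = (δ * h 0) ^ (m - 1) * (K * (δ * h 0)) := by ring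
      _ ≤ (δ * h 0) ^ (m - 1) * 1 := mul_le_mul_of_nonneg_left hδK hpm.le
      _ = _ := mul_one _
  · rw [hd k, hd2 k, hflux, hflux, hss]
    have hp0 : 0 < δ * h k := mul_pos hδ0 (hpos k)
    have hpm : 0 < (δ * h k) ^ (m - 1) := Real.rpow_pos_of_pos hp0 _
    have hws : 0 < w k + w (k+1) := add_pos (hwpos _) (hwpos _)
    rw [le_div_iff₀ hws]
    have e1 : h k ^ (1 - m) ≤ h (k+1) ^ (1 - m) :=
      Real.rpow_le_rpow_of_nonpos (hpos _) (hanti k) (by linarith)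
    have e2 : h (k+1) ^ (1 - m) ≤ R ^ (m - 1) * h k ^ (1 - m) := by
      have : h (k+1) ^ (1 - m) ≤ (h k / R) ^ (1 - m) := by
        apply Real.rpow_le_rpow_of_nonpos (div_pos (hpos k) hR) _ (by linarith)
        rw [div_le_iff₀ hR, mul_comm]; exact hrat k
      rw [Real.div_rpow (hpos k).le hR.le, show (1 - m) = -(m - 1) by ring,
        Real.rpow_neg hR.le, div_inv_eq_mul, mul_comm] at this
      rw [show (1 - m) = -(m - 1) by ring]
      exact this
    have e3 : w k + w (k+1) ≤ 2 * (1 + B) * R ^ (m - 1) * h k ^ (1 - m) := by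
      have a1 := hwB k
      have a2 := hwB (k+1)
      have a3 : (1 + B) * h k ^ (1 - m) ≤ (1 + B) * (R ^ (m - 1) * h k ^ (1 - m)) :=
        mul_le_mul_of_nonneg_left (e1.trans e2) (by linarith)
      have a4 : (1 + B) * h (k+1) ^ (1 - m) ≤ (1 + B) * (R ^ (m - 1) * h k ^ (1 - m)) :=
        mul_le_mul_of_nonneg_left e2 (by linarith)
      linarith
    have e4 : h k ^ (1 - m) * h k ^ (m - 1) = 1 := by
      rw [← Real.rpow_add (hpos k)]; simp
    have e5 : f (k+1) ^ p * (δ * h k) ^ q ≤ K * ((δ * h k) ^ (m - 1) * (δ * h k)) :=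
      mul_le_mul (hfp _) (hpq k) (Real.rpow_pos_of_pos hp0 _).le hK1.le
    have hδm : 0 < δ ^ (m - 1) := Real.rpow_pos_of_pos hδ0 _
    calc f (k+1) ^ p * (δ * h k) ^ q * (w k + w (k+1))
        ≤ K * ((δ * h k) ^ (m - 1) * (δ * h k)) *
          (2 * (1 + B) * R ^ (m - 1) * h k ^ (1 - m)) :=
          mul_le_mul e5 e3 hws.le (by positivity)
      _ = (C * δ) * (δ ^ (m - 1) * h k) * (h k ^ (1 - m) * h k ^ (m - 1)) := by
          rw [Real.mul_rpow hδ0.le (hpos k).le, hC]; ring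
      _ = (C * δ) * (δ ^ (m - 1) * h k) := by rw [e4, mul_one]
      _ ≤ 1 * (δ ^ (m - 1) * h k) :=
          mul_le_mul_of_nonneg_right hδC (mul_pos hδm (hpos k)).le
      _ = _ := by ring
  · have := mul_le_mul_of_nonneg_right (show 1 ≤ 1 + s k by linarith [hs0 k]) (hhm k).le
    simpa [hw] using this

/-- The step profile. -/
noncomputable def hh (s : ℝ) (k : ℕ) : ℝ := 1 / (((k : ℝ) + 2) * Real.log ((k : ℝ) + 2) ^ (1 + s))

theorem log_pos' (k : ℕ) : 0 < Real.log ((k : ℝ) + 2) :=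
  Real.log_pos (by have : (0 : ℝ) ≤ k := Nat.cast_nonneg k; linarith)

theorem hh_pos (s : ℝ) (k : ℕ) : 0 < hh s k := by
  have := Real.rpow_pos_of_pos (log_pos' k) (1 + s)
  unfold hh
  positivity

theorem log_mono' (k : ℕ) : Real.log ((k : ℝ) + 2) ≤ Real.log ((k : ℝ) + 1 + 2) := by
  have : (0 : ℝ) ≤ k := Nat.cast_nonneg k
  exact Real.log_le_log (by linarith) (by linarith)

theorem hh_anti (s : ℝ) (hs : 0 < s) (k : ℕ) : hh s (k+1) ≤ hh s k := by
  have h1 := Real.rpow_pos_of_pos (log_pos' k) (1 + s)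
  have h2 := Real.rpow_le_rpow (log_pos' k).le (log_mono' k) (show 0 ≤ 1 + s by linarith)
  unfold hh
  push_cast
  apply one_div_le_one_div_of_le (by positivity)
  apply mul_le_mul _ h2 h1.le (by positivity)
  linarith

theorem hh_ratio (s : ℝ) (hs : 0 < s) (k : ℕ) : hh s k ≤ (2 * 2 ^ (1 + s)) * hh s (k+1) := by
  have hk : (0 : ℝ) ≤ k := Nat.cast_nonneg k
  have hl := log_pos' k
  have hl' : 0 < Real.log ((k : ℝ) + 1 + 2) := lt_of_lt_of_le hl (log_mono' k)
  have h1 := Real.rpow_pos_of_pos hl (1 + s)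
  have h1' := Real.rpow_pos_of_pos hl' (1 + s)
  have h2 : Real.log ((k : ℝ) + 1 + 2) ≤ 2 * Real.log ((k : ℝ) + 2) := by
    rw [← Real.log_rpow (by linarith)]
    apply Real.log_le_log (by linarith)
    norm_num
    nlinarith
  have h3 := Real.rpow_le_rpow hl'.le h2 (show 0 ≤ 1 + s by linarith)
  rw [Real.mul_rpow (by norm_num) hl.le] at h3
  unfold hh
  push_cast
  rw [mul_one_div, div_le_div_iff₀ (by positivity) (by positivity), one_mul]
  calc ((k : ℝ) + 1 + 2) * Real.log ((k : ℝ) + 1 + 2) ^ (1 + s)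
      ≤ (2 * ((k : ℝ) + 2)) * (2 ^ (1 + s) * Real.log ((k : ℝ) + 2) ^ (1 + s)) :=
        mul_le_mul (by linarith) h3 h1'.le (by linarith)
    _ = _ := by ring

theorem hh_step (s : ℝ) (hs : 0 < s) (k : ℕ) :
    s * hh s (k+1) ≤ Real.log ((k : ℝ) + 2) ^ (-s) - Real.log (((k+1 : ℕ) : ℝ) + 2) ^ (-s) := by
  have hk : (0 : ℝ) ≤ k := Nat.cast_nonneg k
  have hl := log_pos' k
  have hl' : 0 < Real.log ((k : ℝ) + 1 + 2) := lt_of_lt_of_le hl (log_mono' k)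
  unfold hh
  push_cast
  set L1 := Real.log ((k : ℝ) + 2) with hL1
  set L2 := Real.log ((k : ℝ) + 1 + 2) with hL2
  have hdiff : 1 / ((k : ℝ) + 1 + 2) ≤ L2 - L1 := by
    have := Real.log_le_sub_one_of_pos (show 0 < ((k : ℝ) + 2) / ((k : ℝ) + 1 + 2) by positivity)
    rw [Real.log_div (by positivity) (by positivity)] at this
    have e : ((k : ℝ) + 2) / ((k : ℝ) + 1 + 2) - 1 = - (1 / ((k : ℝ) + 1 + 2)) := by
      field_simp; ring
    rw [e] at this
    linarith
  have hbern : 1 + s * (1 - L1 / L2) ≤ (L1 / L2) ^ (-s) := by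
    rw [Real.rpow_def_of_pos (div_pos hl hl')]
    have a := Real.add_one_le_exp (Real.log (L1 / L2) * (-s))
    have b := Real.log_le_sub_one_of_pos (div_pos hl hl')
    nlinarith
  have hP : 0 < L2 ^ (-s) := Real.rpow_pos_of_pos hl' _
  rw [Real.div_rpow hl.le hl'.le, le_div_iff₀ hP] at hbern
  have e1 : L2 ^ (1 + s) = L2 / L2 ^ (-s) := by
    rw [Real.rpow_add hl', Real.rpow_neg hl'.le, Real.rpow_one]; simp
  have e2 : s * (1 / (((k : ℝ) + 1 + 2) * L2 ^ (1 + s))) =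
      s * L2 ^ (-s) / L2 * (1 / ((k : ℝ) + 1 + 2)) := by
    rw [e1]; field_simp
  rw [e2]
  calc s * L2 ^ (-s) / L2 * (1 / ((k : ℝ) + 1 + 2)) ≤ s * L2 ^ (-s) / L2 * (L2 - L1) :=
        mul_le_mul_of_nonneg_left hdiff (by positivity)
    _ = (1 + s * (1 - L1 / L2)) * L2 ^ (-s) - L2 ^ (-s) := by field_simp; ring
    _ ≤ _ := by linarith

theorem hh_sum (s : ℝ) (hs : 0 < s) (n : ℕ) :
    ∑ k ∈ Finset.range n, hh s k ≤ hh s 0 + Real.log ((0 : ℕ) + 2) ^ (-s) / s := by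
  have key : ∀ n : ℕ, ∑ k ∈ Finset.range (n + 1), hh s k ≤
      hh s 0 + (Real.log ((0 : ℕ) + 2) ^ (-s) - Real.log ((n : ℝ) + 2) ^ (-s)) / s := by
    intro n
    induction n with
    | zero => simp
    | succ n ih =>
      rw [Finset.sum_range_succ]
      have h1 := hh_step s hs n
      have h2 : hh s (n+1) ≤
        (Real.log ((n : ℝ) + 2) ^ (-s) - Real.log (((n+1 : ℕ) : ℝ) + 2) ^ (-s)) / s := by
        rw [le_div_iff₀ hs]; linarith
      calc _ ≤ _ := add_le_add ih h2
        _ = _ := by ring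
  rcases n with _ | n
  · have := hh_pos s 0
    have h2 := Real.rpow_pos_of_pos (log_pos' 0) (-s)
    simp only [Finset.range_zero, Finset.sum_empty]
    positivity
  · refine (key n).trans ?_
    have h2 := Real.rpow_pos_of_pos (log_pos' n) (-s)
    gcongr
    linarith

theorem hh_pow (m ε : ℝ) (hm : 1 < m) (k : ℕ) :
    hh (ε / (m - 1)) k ^ (1 - m) =
      ((k : ℝ) + 2) ^ (m - 1) * Real.log ((k : ℝ) + 2) ^ (m - 1 + ε) := by
  have hl := log_pos' k
  have hm' : m - 1 ≠ 0 := by linarith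
  unfold hh
  rw [one_div, Real.inv_rpow (by positivity), ← Real.rpow_neg (by positivity), neg_sub,
    Real.mul_rpow (by positivity) (by positivity), ← Real.rpow_mul hl.le]
  congr 2
  field_simp

theorem sum_bounds (m θ : ℝ) (hm : 1 < m) (hθ : 0 < θ) (w : ℕ → ℝ) (D : ℝ) (hD : 0 < D)
    (hw0 : ∀ k, 0 < w k)
    (h1 : ∀ k : ℕ, ((k : ℝ) + 2) ^ (m - 1) * Real.log ((k : ℝ) + 2) ^ θ ≤ w k)
    (h2 : ∀ k : ℕ, w k ≤ D * (((k : ℝ) + 2) ^ (m - 1) * Real.log ((k : ℝ) + 2) ^ θ)) :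
    ∃ c C : ℝ, 0 < c ∧ 0 < C ∧ ∀ n : ℕ, 2 ≤ n →
      c * ((n : ℝ) ^ m * Real.log n ^ θ) ≤ ∑ k ∈ Finset.range (n + 1), w k ∧
      ∑ k ∈ Finset.range (n + 1), w k ≤ C * ((n : ℝ) ^ m * Real.log n ^ θ) := by
  refine ⟨(1/2) * (1/2) ^ (m - 1) * (1/2) ^ θ, 2 * (D * (2 ^ (m - 1) * 2 ^ θ)),
    by positivity, by positivity, fun n hn => ?_⟩
  have hn' : (2 : ℝ) ≤ n := by exact_mod_cast hn
  have hn0 : (0 : ℝ) < n := by linarith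
  have hL : 0 < Real.log n := Real.log_pos (by linarith)
  have hnm : (n : ℝ) ^ m = n * (n : ℝ) ^ (m - 1) := by
    nth_rewrite 2 [← Real.rpow_one (n : ℝ)]
    rw [← Real.rpow_add hn0]; congr 1; ring
  constructor
  · have hsub : Finset.Icc (n / 2) n ⊆ Finset.range (n + 1) := by
      intro k hk
      simp only [Finset.mem_Icc] at hk
      simp only [Finset.mem_range]
      omega
    have hle : ∀ k ∈ Finset.Icc (n / 2) n,
        ((1/2) * (n : ℝ)) ^ (m - 1) * ((1/2) * Real.log n) ^ θ ≤ w k := by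
      intro k hk
      simp only [Finset.mem_Icc] at hk
      have hk2 : (n : ℝ) ≤ 2 * (k : ℝ) + 1 := by
        have : n ≤ 2 * k + 1 := by omega
        exact_mod_cast this
      refine le_trans ?_ (h1 k)
      have a1 : (1/2) * (n : ℝ) ≤ (k : ℝ) + 2 := by linarith
      have a2 : (1/2) * Real.log n ≤ Real.log ((k : ℝ) + 2) := by
        have : Real.log n ≤ 2 * Real.log ((k : ℝ) + 2) := by
          rw [← Real.log_rpow (by linarith)]
          apply Real.log_le_log hn0
          norm_num
          nlinarith
        linarith
      exact mul_le_mul (Real.rpow_le_rpow (by positivity) a1 (by linarith))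
        (Real.rpow_le_rpow (by positivity) a2 hθ.le) (by positivity) (by positivity)
    have hcard : (1/2) * (n : ℝ) ≤ ((Finset.Icc (n / 2) n).card : ℝ) := by
      rw [Nat.card_Icc]
      have : n ≤ 2 * (n + 1 - n / 2) := by omega
      have : (n : ℝ) ≤ 2 * ((n + 1 - n / 2 : ℕ) : ℝ) := by exact_mod_cast this
      linarith
    calc (1/2) * (1/2) ^ (m - 1) * (1/2) ^ θ * ((n : ℝ) ^ m * Real.log n ^ θ)
        = ((1/2) * (n : ℝ)) * (((1/2) * (n : ℝ)) ^ (m - 1) * ((1/2) * Real.log n) ^ θ) := by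
          rw [Real.mul_rpow (by norm_num) hn0.le, Real.mul_rpow (by norm_num) hL.le, hnm]; ring
      _ ≤ ((Finset.Icc (n / 2) n).card : ℝ) *
          (((1/2) * (n : ℝ)) ^ (m - 1) * ((1/2) * Real.log n) ^ θ) :=
          mul_le_mul_of_nonneg_right hcard (by positivity)
      _ ≤ ∑ k ∈ Finset.Icc (n / 2) n, w k := by
          rw [← nsmul_eq_mul]
          exact Finset.card_nsmul_le_sum _ _ _ hle
      _ ≤ _ := Finset.sum_le_sum_of_subset_of_nonneg hsub fun k _ _ => (hw0 k).le
  · have hle : ∀ k ∈ Finset.range (n + 1),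
        w k ≤ D * ((2 * (n : ℝ)) ^ (m - 1) * (2 * Real.log n) ^ θ) := by
      intro k hk
      have hk' : (k : ℝ) ≤ n := by
        have : k ≤ n := by simpa [Nat.lt_succ_iff] using hk
        exact_mod_cast this
      have hk0 : (0 : ℝ) ≤ k := Nat.cast_nonneg k
      have hl := log_pos' k
      refine (h2 k).trans (mul_le_mul_of_nonneg_left ?_ hD.le)
      have a1 : (k : ℝ) + 2 ≤ 2 * n := by linarith
      have a2 : Real.log ((k : ℝ) + 2) ≤ 2 * Real.log n := by
        rw [← Real.log_rpow hn0]
        apply Real.log_le_log (by linarith)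
        norm_num
        nlinarith
      exact mul_le_mul (Real.rpow_le_rpow (by positivity) a1 (by linarith))
        (Real.rpow_le_rpow hl.le a2 hθ.le) (by positivity) (by positivity)
    calc ∑ k ∈ Finset.range (n + 1), w k
        ≤ ((Finset.range (n + 1)).card : ℝ) *
          (D * ((2 * (n : ℝ)) ^ (m - 1) * (2 * Real.log n) ^ θ)) := by
          rw [← nsmul_eq_mul]
          exact Finset.sum_le_card_nsmul _ _ _ hle
      _ ≤ (2 * (n : ℝ)) * (D * ((2 * (n : ℝ)) ^ (m - 1) * (2 * Real.log n) ^ θ)) := by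
          apply mul_le_mul_of_nonneg_right _ (by positivity)
          rw [Finset.card_range]; push_cast; linarith
      _ = _ := by
          rw [Real.mul_rpow (by norm_num) hn0.le, Real.mul_rpow (by norm_num) hL.le, hnm]; ring

end TreeAux

theorem statement12
    (V : Type*) (G : SimpleGraph V) (N : ℕ) (hN : 2 ≤ N)
    (htree : G.IsTree) (hreg : ∀ v, (G.neighborSet v).ncard = N)
    (o : V)
    (m p q : ℝ) (hm : 1 < m)
    (hq : m ≤ q)
    (ε : ℝ) (hε : 0 < ε) :
    ∃ μ : V → V → ℝ,
      (∀ x y, μ x y = μ y x) ∧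
      (∀ x y, 0 < μ x y ↔ G.Adj x y) ∧
      (∀ x y, ¬ G.Adj x y → μ x y = 0) ∧
      ∃ u : V → ℝ,
        (∀ x, 0 < u x) ∧ (∃ x y, u x ≠ u y) ∧
        (∀ x, q < 0 → 0 < gradNorm μ u x) ∧
        (∀ x, lapM μ m u x + u x ^ p * gradNorm μ u x ^ q ≤ 0) ∧
        ∃ c C : ℝ, 0 < c ∧ 0 < C ∧ ∀ n : ℕ, 2 ≤ n →
          c * ((n : ℝ) ^ m * (Real.log n) ^ (m - 1 + ε)) ≤ Wvol G μ o n ∧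
          Wvol G μ o n ≤
            C * ((n : ℝ) ^ m * (Real.log n) ^ (m - 1 + ε)) := by
  have hm1 : 0 < m - 1 := by linarith
  set s : ℝ := ε / (m - 1) with hs
  have hs0 : 0 < s := div_pos hε hm1
  have hB := TreeAux.hh_sum s hs0
  set B := TreeAux.hh s 0 + Real.log ((0 : ℕ) + 2) ^ (-s) / s
  have hB0 : 0 ≤ B := by simpa using hB 0
  obtain ⟨w, f, hw, hf, hfd, hanti, hroot, hsucc, hw1, hw2⟩ :=
    TreeAux.abs_construct m p q hm hq (TreeAux.hh s) (TreeAux.hh_pos s) (TreeAux.hh_anti s hs0)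
      (2 * 2 ^ (1 + s)) (by positivity) (TreeAux.hh_ratio s hs0) B hB
  obtain ⟨c, C, hc, hC, hcC⟩ := TreeAux.sum_bounds m (m - 1 + ε) hm (by linarith) w (1 + B)
    (by linarith) hw (fun k => by rw [← TreeAux.hh_pow m ε hm k]; exact hw1 k)
    (fun k => by rw [← TreeAux.hh_pow m ε hm k]; exact hw2 k)
  have hN0 : (0 : ℝ) < N := by
    have : (2 : ℝ) ≤ N := by exact_mod_cast hN
    linarith
  refine ⟨TreeAux.radW G o N w, TreeAux.radW_symm G o N w, TreeAux.radW_pos G o hN w hw,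
    fun x y h => TreeAux.radW_non G o N w x y h, fun x => f (G.dist o x), fun x => hf _, ?_,
    fun x hq0 => by linarith, fun x => ?_, N * c, N * C, by positivity, by positivity,
    fun n hn => ?_⟩
  · have hne : (G.neighborSet o).Nonempty := by
      apply Set.nonempty_of_ncard_ne_zero
      rw [hreg]; omega
    obtain ⟨y, hy⟩ := hne
    refine ⟨o, y, ?_⟩
    have hy1 : G.dist o y = 1 := SimpleGraph.dist_eq_one_iff_adj.mpr hy
    have := hfd 0
    simp only [SimpleGraph.dist_self, hy1]
    exact this.ne'
  · have hg0 : 0 ≤ gradNorm (TreeAux.radW G o N w) (fun x => f (G.dist o x)) x :=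
      Real.sqrt_nonneg _
    rcases hk : G.dist o x with _ | k
    · have hox : o = x := htree.connected.dist_eq_zero_iff.mp hk
      subst hox
      obtain ⟨h1, h2⟩ := TreeAux.vert_root hN hreg o w f hw hfd m
      rw [h1]
      have hfx : (fun x => f (G.dist o x)) o = f 0 := congrArg f hk
      rw [hfx]
      have h3 := Real.rpow_le_rpow hg0 h2 (show 0 ≤ q by linarith)
      have h4 := mul_le_mul_of_nonneg_left h3 (Real.rpow_pos_of_pos (hf 0) p).le
      linarith
    · obtain ⟨h1, h2⟩ := TreeAux.vert_succ hN htree hreg o w f hw hfd m x k hk (hanti k)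
      rw [h1]
      have hfx : (fun x => f (G.dist o x)) x = f (k+1) := congrArg f hk
      rw [hfx]
      have h3 := Real.rpow_le_rpow hg0 h2 (show 0 ≤ q by linarith)
      have h4 := mul_le_mul_of_nonneg_left h3 (Real.rpow_pos_of_pos (hf (k+1)) p).le
      have h5 := h4.trans (hsucc k)
      have h6 : (w (k+1) * (f (k+1) - f (k+2)) ^ (m - 1) - w k * (f k - f (k+1)) ^ (m - 1)) /
        (w k + w (k+1)) = - ((w k * (f k - f (k+1)) ^ (m - 1) -
          w (k+1) * (f (k+1) - f (k+2)) ^ (m - 1)) / (w k + w (k+1))) := by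
        rw [← neg_div]; ring
      rw [h6] at h5
      linarith
  · rw [TreeAux.wvol_eq hN htree hreg o w n]
    obtain ⟨h1, h2⟩ := hcC n hn
    constructor
    · rw [mul_assoc]; exact mul_le_mul_of_nonneg_left h1 hN0.le
    · rw [mul_assoc]; exact mul_le_mul_of_nonneg_left h2 hN0.le
end

section
/- Let m>1 and suppose p < 0 and m−1 < q < m (region G₃). Then for every ε>0 there exists an edge weight μ on the homogeneous tree T_N and a nonconstant positive function u on T_N such that W_o(n) ≍ n^{q/(q−m+1)}·(ln n)^{(m−1)/(q−m+1)+ε} for all n ≥ 2, and u satisfies Δ_m u(x) + u(x)^p·|∇u(x)|^q ≤ 0 at every vertex x of T_N; i.e., (★) admits a nontrivial positive solution on (T_N, μ). -/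
variable {V : Type*}

section Aux

open Real Finset

lemma aux_summable (s : ℝ) (hs : 0 < s) :
    Summable (fun n : ℕ => 1 / (((n:ℝ) + 2) * (Real.log ((n:ℝ) + 2)) ^ (1 + s))) := by
  have hlog : ∀ n : ℕ, 0 < Real.log ((n:ℝ) + 2) := fun n => Real.log_pos (by linarith [Nat.cast_nonneg (α := ℝ) n])
  rw [← summable_condensed_iff_of_nonneg]
  · rw [← summable_nat_add_iff 1]
    have h1 : Summable (fun n : ℕ => (Real.log 2) ^ (-(1+s)) * (1 / ((n+1 : ℕ) : ℝ) ^ (1 + s))) :=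
      ((summable_nat_add_iff 1).2 (Real.summable_one_div_nat_rpow.2 (by linarith))).mul_left _
    refine Summable.of_nonneg_of_le (fun n => ?_) (fun n => ?_) h1
    · have := hlog (2 ^ (n+1)); positivity
    · have h2 : (0:ℝ) < Real.log 2 := Real.log_pos (by norm_num)
      have h3 : ((n+1 : ℕ) : ℝ) * Real.log 2 ≤ Real.log (((2 ^ (n+1) : ℕ) : ℝ) + 2) := by
        rw [← Real.log_pow]
        apply Real.log_le_log (by positivity)
        push_cast; linarith
      have h4 : (((n+1 : ℕ) : ℝ) * Real.log 2) ^ (1+s) ≤ Real.log (((2 ^ (n+1) : ℕ) : ℝ) + 2) ^ (1+s) :=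
        Real.rpow_le_rpow (by positivity) h3 (by linarith)
      rw [Real.mul_rpow (by positivity) h2.le] at h4
      rw [Real.rpow_neg h2.le]
      have hp : 0 < ((n+1 : ℕ) : ℝ) ^ (1+s) * Real.log 2 ^ (1+s) := by positivity
      have h5 : (2:ℝ) ^ (n+1) * (1 / ((((2 ^ (n+1) : ℕ) : ℝ) + 2) * Real.log (((2 ^ (n+1) : ℕ) : ℝ) + 2) ^ (1+s)))
         ≤ 1 / Real.log (((2 ^ (n+1) : ℕ) : ℝ) + 2) ^ (1+s) := by
        have hh := hlog (2 ^ (n+1))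
        have hA : 0 < Real.log (((2 ^ (n+1) : ℕ) : ℝ) + 2) ^ (1+s) := by positivity
        rw [mul_one_div, div_le_div_iff₀ (by positivity) hA]
        push_cast
        push_cast at hA
        nlinarith
      refine h5.trans ((one_div_le_one_div_of_le hp h4).trans (le_of_eq ?_))
      field_simp
  · intro n; have := hlog n; positivity
  · intro a b _ hab
    have := hlog a; have := hlog b
    apply one_div_le_one_div_of_le (by positivity)
    have : (a:ℝ) ≤ b := by exact_mod_cast hab
    gcongr

lemma aux_vol (θ ε : ℝ) (hθ : 0 < θ) (hε : 0 < ε) :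
    ∃ c C : ℝ, 0 < c ∧ 0 < C ∧ ∀ n : ℕ, 2 ≤ n →
      c * ((n:ℝ) ^ (θ + 1) * (Real.log n) ^ (θ + ε)) ≤
        ∑ k ∈ range (n+1), (((k:ℝ) + 2) ^ θ * (Real.log ((k:ℝ) + 2)) ^ (θ + ε)) ∧
      ∑ k ∈ range (n+1), (((k:ℝ) + 2) ^ θ * (Real.log ((k:ℝ) + 2)) ^ (θ + ε)) ≤
        C * ((n:ℝ) ^ (θ + 1) * (Real.log n) ^ (θ + ε)) := by
  have hlog : ∀ n : ℕ, 0 < Real.log ((n:ℝ) + 2) := fun n => Real.log_pos (by linarith [Nat.cast_nonneg (α := ℝ) n])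
  refine ⟨(1/2) * ((1/2) ^ θ * (1/2) ^ (θ + ε)), 2 * (2 ^ θ * 2 ^ (θ + ε)), by positivity, by positivity, fun n hn => ?_⟩
  have hn' : (2:ℝ) ≤ n := by exact_mod_cast hn
  have hn0 : (0:ℝ) < n := by linarith
  have hl0 : 0 < Real.log n := Real.log_pos (by linarith)
  have hpow : (n:ℝ) ^ (θ + 1) = n * (n:ℝ) ^ θ := by rw [Real.rpow_add hn0, Real.rpow_one]; ring
  rw [hpow]
  constructor
  · have hsub : Ico (n / 2) (n+1) ⊆ range (n+1) := by
      intro k hk; simp at hk ⊢; omega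
    refine le_trans ?_ (sum_le_sum_of_subset_of_nonneg hsub ?_)
    · refine le_trans ?_ (card_nsmul_le_sum _ _ (((1/2) * (n:ℝ)) ^ θ * ((1/2) * Real.log n) ^ (θ + ε)) ?_)
      · rw [Real.mul_rpow (by norm_num) hn0.le, Real.mul_rpow (by norm_num) hl0.le, nsmul_eq_mul, Nat.card_Ico]
        have : (n:ℝ) ≤ 2 * ((n + 1 - n / 2 : ℕ) : ℝ) := by
          have : n ≤ 2 * (n + 1 - n / 2) := by omega
          exact_mod_cast this
        have hB : 0 < (1/2 : ℝ) ^ θ * (n:ℝ) ^ θ * ((1/2 : ℝ) ^ (θ + ε) * Real.log n ^ (θ + ε)) := by positivity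
        nlinarith
      · intro k hk
        simp only [mem_Ico] at hk
        have hk' : (n:ℝ) ≤ 2 * (k:ℝ) + 1 := by
          have : n ≤ 2 * k + 1 := by omega
          exact_mod_cast this
        have h1 : (1/2) * (n:ℝ) ≤ (k:ℝ) + 2 := by linarith
        have h2 : (1/2) * Real.log n ≤ Real.log ((k:ℝ) + 2) := by
          have : Real.log n ≤ Real.log (((k:ℝ) + 2) ^ 2) := by
            apply Real.log_le_log hn0
            nlinarith [Nat.cast_nonneg (α := ℝ) k]
          rw [Real.log_pow] at this
          push_cast at this
          linarith
        gcongr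
    · intro k _ _
      have := hlog k
      positivity
  · refine le_trans (sum_le_card_nsmul _ _ ((2 * (n:ℝ)) ^ θ * (2 * Real.log n) ^ (θ + ε)) ?_) ?_
    · intro k hk
      simp only [mem_range] at hk
      have hk' : (k:ℝ) ≤ n := by
        have : k ≤ n := by omega
        exact_mod_cast this
      have h2 : Real.log ((k:ℝ) + 2) ≤ 2 * Real.log n := by
        have : Real.log ((k:ℝ) + 2) ≤ Real.log ((n:ℝ) ^ 2) := by
          apply Real.log_le_log (by positivity)
          nlinarith
        rw [Real.log_pow] at this
        exact_mod_cast this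
      have h1 : (k:ℝ) + 2 ≤ 2 * n := by linarith
      have := hlog k
      gcongr
    · rw [Real.mul_rpow (by norm_num) hn0.le, Real.mul_rpow (by norm_num) hl0.le, nsmul_eq_mul, card_range]
      push_cast
      have hB : 0 < (2 : ℝ) ^ θ * (n:ℝ) ^ θ * ((2 : ℝ) ^ (θ + ε) * Real.log n ^ (θ + ε)) := by positivity
      nlinarith

lemma aux_core (m p q : ℝ) (hm : 1 < m) (hp : p < 0) (hq1 : m - 1 < q) (hq2 : q < m)
    (g : ℕ → ℝ) (hg : ∀ n, 0 < g n) (hanti : ∀ n, g (n+1) ≤ g n) (hs : Summable g)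
    (R : ℝ) (hR : 0 < R) (hgR : ∀ n, g n ≤ R * g (n+1)) :
    ∃ δ φ : ℕ → ℝ, (∀ n, 0 < δ n) ∧ (∀ n, 0 < φ n) ∧ (∀ n, φ n - φ (n+1) = δ n) ∧
      (g 0 ^ (-((m-1)/(q-m+1))) * (φ 0 ^ p * δ 0 ^ q) ≤ g 0 ^ (-((m-1)/(q-m+1))) * δ 0 ^ (m-1)) ∧
      ∀ n, (g n ^ (-((m-1)/(q-m+1))) + g (n+1) ^ (-((m-1)/(q-m+1)))) *
          (φ (n+1) ^ p * (max (δ n) (δ (n+1))) ^ q) ≤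
        g (n+1) ^ (-((m-1)/(q-m+1))) * δ (n+1) ^ (m-1) - g n ^ (-((m-1)/(q-m+1))) * δ n ^ (m-1) := by
  have hr : 0 < q - m + 1 := by linarith
  have hm1 : 0 < m - 1 := by linarith
  have hq0 : 0 < q := by linarith
  obtain ⟨θ, hθ⟩ : ∃ θ, θ = (m-1)/(q-m+1) := ⟨_, rfl⟩
  have hθ0 : 0 < θ := by rw [hθ]; positivity
  obtain ⟨a, ha⟩ : ∃ a, a = 1/(q-m+1) := ⟨_, rfl⟩
  have ha1 : 1 < a := by rw [ha, lt_div_iff₀ hr]; linarith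
  have haθ : a * (m-1) = θ := by rw [ha, hθ]; field_simp
  have haq : a * q = 1 + θ := by rw [ha, hθ]; field_simp; ring
  rw [← hθ]
  let F : ℕ → ℝ := fun n => g 0 + ∑ k ∈ range n, g k
  let K : ℝ := g 0 + ∑' k, g k
  have hF0 : ∀ n, 0 < F n := fun n => add_pos_of_pos_of_nonneg (hg 0) (sum_nonneg fun k _ => (hg k).le)
  have hFK : ∀ n, F n ≤ K := fun n => by
    have := hs.sum_le_tsum (range n) (fun k _ => (hg k).le)
    simp only [F, K]; linarith
  have hK : 0 < K := (hF0 0).trans_le (hFK 0)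
  let δ : ℕ → ℝ := fun n => F n ^ (1/(m-1)) * g n ^ a
  let D : ℕ → ℝ := fun n => K ^ (1/(m-1)) * g n ^ a
  have hδ0 : ∀ n, 0 < δ n := fun n => by have := hF0 n; have := hg n; positivity
  have hδD : ∀ n, δ n ≤ D n := fun n => by
    have h1 := hF0 n; have h2 := hg n; have h3 := hFK n
    simp only [δ, D]
    gcongr
  have hD : ∀ n, D (n+1) ≤ D n := fun n => by
    have h1 := hg n; have h2 := hg (n+1); have h3 := hanti n
    simp only [D]
    gcongr
  have hwδ : ∀ n, g n ^ (-θ) * δ n ^ (m-1) = F n := fun n => by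
    have h1 := hF0 n; have h2 := hg n
    simp only [δ]
    rw [Real.mul_rpow (by positivity) (by positivity), ← Real.rpow_mul h1.le, ← Real.rpow_mul h2.le, haθ,
      one_div_mul_cancel hm1.ne', Real.rpow_one, mul_left_comm, ← Real.rpow_add h2]
    simp
  have hg0 : ∀ n, g n ≤ g 0 := fun n => (antitone_nat_of_succ_le hanti) (Nat.zero_le n)
  have hδs : Summable δ := by
    refine Summable.of_nonneg_of_le (fun n => (hδ0 n).le) (fun n => ?_)
      (hs.mul_left (K ^ (1/(m-1)) * g 0 ^ (a - 1)))
    refine (hδD n).trans ?_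
    simp only [D]
    have h2 := hg n
    have : g n ^ a = g n ^ (a-1) * g n := by
      rw [← Real.rpow_add_one h2.ne']; ring_nf
    rw [this, ← mul_assoc]
    have h3 := hg0 n
    have h4 : 0 ≤ a - 1 := by linarith
    gcongr
  let T := ∑' k, δ k
  obtain ⟨B, hB⟩ : ∃ B, B = (1 + R ^ θ) * (K ^ (1/(m-1))) ^ q := ⟨_, rfl⟩
  have hB0 : 0 < B := by rw [hB]; positivity
  -- L
  let L : ℝ := (1/B) ^ (1/p)
  have hL0 : 0 < L := by positivity
  have hLp : L ^ p = 1/B := by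
    simp only [L]
    rw [← Real.rpow_mul (by positivity), one_div_mul_cancel hp.ne, Real.rpow_one]
  let φ : ℕ → ℝ := fun n => L + (T - ∑ k ∈ range n, δ k)
  have hφL : ∀ n, L ≤ φ n := fun n => by
    have := hδs.sum_le_tsum (range n) (fun k _ => (hδ0 k).le)
    simp only [φ, T]; linarith
  have hφp : ∀ n, φ n ^ p ≤ 1/B := fun n => by
    rw [← hLp]
    exact Real.rpow_le_rpow_of_nonpos hL0 (hφL n) hp.le
  have hφ0 : ∀ n, 0 < φ n := fun n => hL0.trans_le (hφL n)
  have hDq : ∀ n, (1 + R ^ θ) * (g n ^ (-θ) * D n ^ q) = B * g n := fun n => by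
    have h2 := hg n
    simp only [D]
    rw [Real.mul_rpow (by positivity) (by positivity), ← Real.rpow_mul h2.le, haq, mul_left_comm (g n ^ (-θ)), ← Real.rpow_add h2, hB]
    simp [mul_assoc]
  have hmain : ∀ n i, ∀ d, 0 < d → d ≤ D n → (1 + R ^ θ) * g n ^ (-θ) * (φ i ^ p * d ^ q) ≤ g n := by
    intro n i d hd0 hd
    have h2 := hg n
    have h3 : d ^ q ≤ D n ^ q := Real.rpow_le_rpow hd0.le hd hq0.le
    have h4 := hφp i
    have h5 := hφ0 i
    calc (1 + R ^ θ) * g n ^ (-θ) * (φ i ^ p * d ^ q)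
        ≤ (1 + R ^ θ) * g n ^ (-θ) * (1/B * D n ^ q) := by gcongr
      _ = 1/B * ((1 + R ^ θ) * (g n ^ (-θ) * D n ^ q)) := by ring
      _ = g n := by rw [hDq]; field_simp
  refine ⟨δ, φ, hδ0, hφ0, fun n => ?_, ?_, fun n => ?_⟩
  · simp only [φ, sum_range_succ]; ring
  · rw [hwδ 0]
    have h1 := hmain 0 0 (δ 0) (hδ0 0) (hδD 0)
    have h2 := hg 0
    have h3 := hφ0 0
    have h4 := hδ0 0
    have h5 : 0 < g 0 ^ (-θ) * (φ 0 ^ p * δ 0 ^ q) := by positivity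
    have h6 : 0 < R ^ θ := by positivity
    have h7 : F 0 = g 0 := by simp [F]
    rw [h7]
    nlinarith
  · rw [hwδ, hwδ]
    have h0 : F (n+1) - F n = g n := by simp only [F, sum_range_succ]; ring
    rw [h0]
    have hmx : 0 < max (δ n) (δ (n+1)) := lt_max_of_lt_left (hδ0 n)
    refine le_trans ?_ (hmain n (n+1) (max (δ n) (δ (n+1))) hmx
      (max_le (hδD n) ((hδD (n+1)).trans (hD n))))
    have h1 : g (n+1) ^ (-θ) ≤ R ^ θ * g n ^ (-θ) := by
      have h2 := hg n
      have h3 := hg (n+1)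
      have h4 : g n ^ θ ≤ R ^ θ * g (n+1) ^ θ := by
        rw [← Real.mul_rpow hR.le h3.le]
        exact Real.rpow_le_rpow h2.le (hgR n) hθ0.le
      rw [Real.rpow_neg h2.le, Real.rpow_neg h3.le, ← div_eq_mul_inv, inv_eq_one_div,
        div_le_div_iff₀ (by positivity) (by positivity)]
      linarith
    have h5 := hφ0 (n+1)
    gcongr
    linarith

lemma aux_analytic (m p q ε : ℝ) (hm : 1 < m) (hp : p < 0) (hq1 : m - 1 < q) (hq2 : q < m)
    (hε : 0 < ε) :
    ∃ w δ φ : ℕ → ℝ, (∀ n, 0 < w n) ∧ (∀ n, 0 < δ n) ∧ (∀ n, 0 < φ n) ∧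
      (∀ n, φ n - φ (n+1) = δ n) ∧
      (w 0 * (φ 0 ^ p * δ 0 ^ q) ≤ w 0 * δ 0 ^ (m-1)) ∧
      (∀ n, (w n + w (n+1)) * (φ (n+1) ^ p * (max (δ n) (δ (n+1))) ^ q) ≤
        w (n+1) * δ (n+1) ^ (m-1) - w n * δ n ^ (m-1)) ∧
      ∃ c C : ℝ, 0 < c ∧ 0 < C ∧ ∀ n : ℕ, 2 ≤ n →
          c * ((n : ℝ) ^ (q / (q - m + 1)) *
              (Real.log n) ^ ((m - 1) / (q - m + 1) + ε)) ≤ ∑ k ∈ range (n+1), w k ∧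
          ∑ k ∈ range (n+1), w k ≤
            C * ((n : ℝ) ^ (q / (q - m + 1)) *
              (Real.log n) ^ ((m - 1) / (q - m + 1) + ε)) := by
  have hr : 0 < q - m + 1 := by linarith
  have hm1 : 0 < m - 1 := by linarith
  obtain ⟨θ, hθ⟩ : ∃ θ, θ = (m-1)/(q-m+1) := ⟨_, rfl⟩
  have hθ0 : 0 < θ := by rw [hθ]; positivity
  have hlog : ∀ n : ℕ, 0 < Real.log ((n:ℝ) + 2) := fun n => Real.log_pos (by linarith [Nat.cast_nonneg (α := ℝ) n])
  let s := ε / θ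
  have hs0 : 0 < s := by positivity
  let g : ℕ → ℝ := fun n => 1 / (((n:ℝ) + 2) * (Real.log ((n:ℝ) + 2)) ^ (1 + s))
  have hg : ∀ n, 0 < g n := fun n => by have := hlog n; positivity
  have hanti : ∀ n, g (n+1) ≤ g n := fun n => by
    have h1 := hlog n
    have h2 := hlog (n+1)
    apply one_div_le_one_div_of_le (by positivity)
    push_cast
    gcongr <;> linarith
  have hgR : ∀ n, g n ≤ (2 * 2 ^ (1+s)) * g (n+1) := fun n => by
    have h1 := hlog n
    have h2 := hlog (n+1)
    have hn : (0:ℝ) ≤ n := Nat.cast_nonneg n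
    have h3 : Real.log (((n+1:ℕ):ℝ) + 2) ≤ 2 * Real.log ((n:ℝ) + 2) := by
      have : Real.log (((n+1:ℕ):ℝ) + 2) ≤ Real.log (((n:ℝ) + 2) ^ 2) := by
        apply Real.log_le_log (by positivity)
        push_cast; nlinarith
      rw [Real.log_pow] at this
      exact_mod_cast this
    have h4 : Real.log (((n+1:ℕ):ℝ) + 2) ^ (1+s) ≤ 2 ^ (1+s) * Real.log ((n:ℝ) + 2) ^ (1+s) := by
      rw [← Real.mul_rpow (by norm_num) h1.le]
      exact Real.rpow_le_rpow h2.le h3 (by positivity)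
    have h5 : ((n+1:ℕ):ℝ) + 2 ≤ 2 * ((n:ℝ) + 2) := by push_cast; linarith
    simp only [g]
    rw [mul_one_div, div_le_div_iff₀ (by positivity) (by positivity), one_mul]
    calc _ ≤ (2 * ((n:ℝ) + 2)) * (2 ^ (1+s) * Real.log ((n:ℝ) + 2) ^ (1+s)) := by gcongr
      _ = _ := by ring
  obtain ⟨δ, φ, h1, h2, h3, h4, h5⟩ := aux_core m p q hm hp hq1 hq2 g hg hanti (aux_summable s hs0)
    (2 * 2 ^ (1+s)) (by positivity) hgR
  refine ⟨fun n => g n ^ (-((m-1)/(q-m+1))), δ, φ, fun n => Real.rpow_pos_of_pos (hg n) _, h1, h2, h3, h4, h5, ?_⟩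
  have hq' : q / (q - m + 1) = θ + 1 := by rw [hθ]; field_simp; ring
  have hw : ∀ k, g k ^ (-θ) = ((k:ℝ) + 2) ^ θ * (Real.log ((k:ℝ) + 2)) ^ (θ + ε) := fun k => by
    have h := hlog k
    have he : (1 + s) * θ = θ + ε := by simp only [s]; field_simp
    simp only [g]
    rw [one_div, Real.inv_rpow (by positivity), Real.rpow_neg (by positivity), inv_inv,
      Real.mul_rpow (by positivity) (by positivity), ← Real.rpow_mul h.le, he]
  rw [hq', ← hθ]
  simp only [hw]
  exact aux_vol θ ε hθ0 hε

end Aux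

/-- number of children of a vertex at level `k` -/
def chN (N k : ℕ) : ℕ := if k = 0 then N else N - 1

/-- number of vertices at level `k` -/
def sphN (N : ℕ) : ℕ → ℕ
  | 0 => 1
  | k+1 => sphN N k * chN N k

lemma aux_parent {V : Type*} {G : SimpleGraph V} (htree : G.IsTree) (o x : V) (hx : G.dist o x ≠ 0) :
    ∃ y, G.Adj x y ∧ G.dist o y + 1 = G.dist o x ∧
      ∀ z, G.Adj x z → G.dist o z + 1 = G.dist o x → z = y := by
  obtain ⟨P, hP, hPl⟩ := htree.connected.exists_path_of_dist o x
  have hnil : ¬ P.Nil := by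
    intro h
    have := SimpleGraph.Walk.length_eq_zero_iff.2 h
    omega
  have hadj := P.adj_penultimate hnil
  have key : ∀ z, G.Adj x z → G.dist o z + 1 = G.dist o x → z = P.penultimate := by
    intro z hz hd
    obtain ⟨Q, hQ, hQl⟩ := htree.connected.exists_path_of_dist o z
    have hl : (Q.concat hz.symm).length = G.dist o x := by
      rw [SimpleGraph.Walk.length_concat]; omega
    have hQ' := (Q.concat hz.symm).isPath_of_length_eq_dist hl
    have : Q.concat hz.symm = P := (htree.existsUnique_path o x).unique hQ' hP
    rw [← this, SimpleGraph.Walk.penultimate_concat]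
  refine ⟨P.penultimate, hadj.symm, ?_, key⟩
  have h1 : G.dist o P.penultimate ≤ P.dropLast.length := SimpleGraph.dist_le _
  have h2 : P.dropLast.length + 1 = P.length := SimpleGraph.Walk.length_dropLast_add_one hnil
  rcases htree.dist_eq_dist_add_one_of_adj o hadj with h | h <;> omega

open Classical in
lemma aux_nb {V : Type*} {G : SimpleGraph V} {N : ℕ} (hN : 2 ≤ N)
    (htree : G.IsTree) (hreg : ∀ v, (G.neighborSet v).ncard = N) (o x : V) :
    ∃ A B : Finset V, Disjoint A B ∧ (∀ y, y ∈ A ↔ G.Adj x y ∧ G.dist o y + 1 = G.dist o x) ∧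
      (∀ y, y ∈ B ↔ G.Adj x y ∧ G.dist o y = G.dist o x + 1) ∧
      A.card = (if G.dist o x = 0 then 0 else 1) ∧ B.card = chN N (G.dist o x) := by
  have hfin : (G.neighborSet x).Finite := Set.finite_of_ncard_pos (by rw [hreg]; omega)
  let S := hfin.toFinset
  have hS : S.card = N := by rw [← hreg x, Set.ncard_eq_toFinset_card _ hfin]
  have hmem : ∀ y, y ∈ S ↔ G.Adj x y := fun y => by simp [S]
  let A := S.filter (fun y => G.dist o y + 1 = G.dist o x)
  let B := S.filter (fun y => G.dist o y = G.dist o x + 1)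
  have hd : Disjoint A B := by
    rw [Finset.disjoint_left]; intro y hy hy'
    simp only [A, B, Finset.mem_filter] at hy hy'; omega
  have hU : A ∪ B = S := by
    ext y
    simp only [A, B, Finset.mem_union, Finset.mem_filter]
    constructor
    · rintro (h | h) <;> exact h.1
    · intro h
      rcases htree.dist_eq_dist_add_one_of_adj o ((hmem y).1 h) with h' | h'
      · left; exact ⟨h, h'.symm⟩
      · right; exact ⟨h, h'⟩
  have hA : A.card = (if G.dist o x = 0 then 0 else 1) := by
    split_ifs with h0
    · rw [Finset.card_eq_zero]; ext y; simp [A, h0]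
    · obtain ⟨y, hy1, hy2, hy3⟩ := aux_parent htree o x h0
      rw [Finset.card_eq_one]
      refine ⟨y, ?_⟩
      ext z
      simp only [A, Finset.mem_filter, hmem, Finset.mem_singleton]
      constructor
      · rintro ⟨h, h'⟩; exact hy3 z h h'
      · rintro rfl; exact ⟨hy1, hy2⟩
  refine ⟨A, B, hd, fun y => by simp [A, hmem], fun y => by simp [B, hmem], hA, ?_⟩
  have := Finset.card_union_of_disjoint hd
  rw [hU, hS, hA] at this
  unfold chN
  split_ifs at this ⊢ <;> omega

lemma aux_finsum {V : Type*} {G : SimpleGraph V} {N : ℕ} (hN : 2 ≤ N)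
    (htree : G.IsTree) (hreg : ∀ v, (G.neighborSet v).ncard = N) (o x : V)
    (f : V → ℝ) (P Q : ℝ) (h0 : ∀ y, ¬ G.Adj x y → f y = 0)
    (h1 : ∀ y, G.Adj x y → G.dist o y + 1 = G.dist o x → f y = P)
    (h2 : ∀ y, G.Adj x y → G.dist o y = G.dist o x + 1 → f y = Q) :
    ∑ᶠ y, f y = (if G.dist o x = 0 then 0 else P) + chN N (G.dist o x) * Q := by
  classical
  obtain ⟨A, B, hd, hA, hB, hAc, hBc⟩ := aux_nb hN htree hreg o x
  rw [finsum_eq_sum_of_support_subset f (s := A ∪ B), Finset.sum_union hd]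
  · rw [Finset.sum_congr rfl (fun y hy => h1 y ((hA y).1 hy).1 ((hA y).1 hy).2),
      Finset.sum_congr rfl (fun y hy => h2 y ((hB y).1 hy).1 ((hB y).1 hy).2)]
    simp only [Finset.sum_const, hAc, hBc, nsmul_eq_mul]
    split_ifs <;> simp
  · intro y hy
    have hadj : G.Adj x y := by by_contra h; exact hy (h0 y h)
    simp only [Finset.coe_union, Set.mem_union, Finset.mem_coe, hA, hB]
    rcases htree.dist_eq_dist_add_one_of_adj o hadj with h' | h'
    · left; exact ⟨hadj, h'.symm⟩
    · right; exact ⟨hadj, h'⟩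

lemma aux_level {V : Type*} {G : SimpleGraph V} {N : ℕ} (hN : 2 ≤ N)
    (htree : G.IsTree) (hreg : ∀ v, (G.neighborSet v).ncard = N) (o : V) (n : ℕ) :
    ∃ L : Finset V, (∀ x, x ∈ L ↔ G.dist o x = n) ∧ L.card = sphN N n := by
  classical
  induction n with
  | zero =>
    refine ⟨{o}, fun x => ?_, by simp [sphN]⟩
    rw [htree.connected.dist_eq_zero_iff, Finset.mem_singleton, eq_comm]
  | succ n ih =>
    obtain ⟨L, hL, hLc⟩ := ih
    choose A B hd hA hB hAc hBc using fun x => aux_nb hN htree hreg o x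
    refine ⟨L.biUnion B, fun y => ?_, ?_⟩
    · simp only [Finset.mem_biUnion, hB, hL]
      constructor
      · rintro ⟨x, hx, _, h⟩; omega
      · intro h
        obtain ⟨x, hx, hx', _⟩ := aux_parent htree o y (by omega)
        exact ⟨x, by omega, hx.symm, by omega⟩
    · rw [Finset.card_biUnion, Finset.sum_congr rfl (g := fun _ => chN N n)]
      · simp [sphN, hLc]
      · intro x hx; rw [hBc, (hL x).1 hx]
      · intro x hx x' hx' hne
        simp only [Function.onFun]
        rw [Finset.disjoint_left]
        intro y hy hy'
        rw [hB] at hy hy'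
        obtain ⟨z, _, _, hz⟩ := aux_parent htree o y (by omega)
        exact hne ((hz x hy.1.symm (by omega)).trans (hz x' hy'.1.symm (by omega)).symm)

lemma aux_ballsum {V : Type*} {G : SimpleGraph V} {N : ℕ} (hN : 2 ≤ N)
    (htree : G.IsTree) (hreg : ∀ v, (G.neighborSet v).ncard = N) (o : V) (n : ℕ)
    (f : V → ℝ) (b : ℕ → ℝ) (h1 : ∀ x, G.dist o x ≤ n → f x = b (G.dist o x))
    (h2 : ∀ x, n < G.dist o x → f x = 0) :
    ∑ᶠ x, f x = ∑ k ∈ Finset.range (n+1), (sphN N k : ℝ) * b k := by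
  classical
  choose L hL hLc using fun k => aux_level hN htree hreg o k
  rw [finsum_eq_sum_of_support_subset f (s := (Finset.range (n+1)).biUnion L), Finset.sum_biUnion]
  · refine Finset.sum_congr rfl fun k hk => ?_
    rw [Finset.sum_congr rfl (g := fun _ => b k)]
    · simp [hLc]
    · intro x hx
      have := (hL k x).1 hx
      rw [h1 x (by simp at hk; omega), this]
  · intro i _ j _ hij
    simp only [Function.onFun]
    rw [Finset.disjoint_left]
    intro y hy hy'
    rw [hL] at hy hy'
    exact hij (hy.symm.trans hy')
  · intro x hx
    simp only [Finset.coe_biUnion, Set.mem_iUnion, Finset.mem_coe, hL, Finset.mem_range]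
    refine ⟨G.dist o x, ?_, rfl⟩
    by_contra h
    exact hx (h2 x (by omega))

theorem statement13
    (V : Type*) (G : SimpleGraph V) (N : ℕ) (hN : 2 ≤ N)
    (htree : G.IsTree) (hreg : ∀ v, (G.neighborSet v).ncard = N)
    (o : V)
    (m p q : ℝ) (hm : 1 < m)
    (hp : p < 0) (hq1 : m - 1 < q) (hq2 : q < m)
    (ε : ℝ) (hε : 0 < ε) :
    ∃ μ : V → V → ℝ,
      (∀ x y, μ x y = μ y x) ∧
      (∀ x y, 0 < μ x y ↔ G.Adj x y) ∧
      (∀ x y, ¬ G.Adj x y → μ x y = 0) ∧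
      ∃ u : V → ℝ,
        (∀ x, 0 < u x) ∧ (∃ x y, u x ≠ u y) ∧
        (∀ x, q < 0 → 0 < gradNorm μ u x) ∧
        (∀ x, lapM μ m u x + u x ^ p * gradNorm μ u x ^ q ≤ 0) ∧
        ∃ c C : ℝ, 0 < c ∧ 0 < C ∧ ∀ n : ℕ, 2 ≤ n →
          c * ((n : ℝ) ^ (q / (q - m + 1)) *
              (Real.log n) ^ ((m - 1) / (q - m + 1) + ε)) ≤ Wvol G μ o n ∧
          Wvol G μ o n ≤
            C * ((n : ℝ) ^ (q / (q - m + 1)) *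
              (Real.log n) ^ ((m - 1) / (q - m + 1) + ε)) := by
  classical
  obtain ⟨w, δ, φ, hw, hδ, hφ, hφδ, hroot, hstep, c, C, hc, hC, hvol⟩ :=
    aux_analytic m p q ε hm hp hq1 hq2 hε
  have hq0 : 0 < q := by linarith
  have hch : ∀ k, 0 < chN N k := fun k => by unfold chN; split_ifs <;> omega
  have hS : ∀ k, 0 < sphN N k := fun k => by
    induction k with
    | zero => simp [sphN]
    | succ k ih => exact Nat.mul_pos ih (hch k)
  have hch' : ∀ k, (0:ℝ) < chN N k := fun k => by exact_mod_cast hch k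
  have hS' : ∀ k, (0:ℝ) < sphN N k := fun k => by exact_mod_cast hS k
  let a : ℕ → ℝ := fun k => w k / sphN N (k+1)
  have ha : ∀ k, 0 < a k := fun k => div_pos (hw k) (hS' _)
  have hca : ∀ k, (chN N k : ℝ) * a k = w k / sphN N k := fun k => by
    have h1 := (hS' k).ne'
    have h2 := (hch' k).ne'
    simp only [a, sphN]
    push_cast
    field_simp
  let μ : V → V → ℝ := fun x y => if G.Adj x y then a (min (G.dist o x) (G.dist o y)) else 0
  let u : V → ℝ := fun x => φ (G.dist o x)
  have hμ0 : ∀ x y, ¬ G.Adj x y → μ x y = 0 := fun x y h => if_neg h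
  have hμ1 : ∀ x y, G.Adj x y → G.dist o y + 1 = G.dist o x → μ x y = a (G.dist o x - 1) := by
    intro x y h h'
    simp only [μ, if_pos h]
    congr 1; omega
  have hμ2 : ∀ x y, G.Adj x y → G.dist o y = G.dist o x + 1 → μ x y = a (G.dist o x) := by
    intro x y h h'
    simp only [μ, if_pos h]
    congr 1; omega
  have hu1 : ∀ x y, G.dist o y + 1 = G.dist o x → u y - u x = δ (G.dist o x - 1) := by
    intro x y h
    simp only [u, ← h, ← hφδ, Nat.add_sub_cancel]
  have hu2 : ∀ x y, G.dist o y = G.dist o x + 1 → u y - u x = - δ (G.dist o x) := by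
    intro x y h
    simp only [u, h, ← hφδ]; ring
  have hM : ∀ x, vMeasure μ x = (if G.dist o x = 0 then 0 else a (G.dist o x - 1)) +
      chN N (G.dist o x) * a (G.dist o x) := fun x =>
    aux_finsum hN htree hreg o x (fun y => μ x y) _ _ (hμ0 x) (hμ1 x) (hμ2 x)
  have hδm : ∀ k, |δ k| ^ (m - 2) * δ k = δ k ^ (m - 1) := fun k => by
    rw [abs_of_pos (hδ k), ← Real.rpow_add_one (hδ k).ne']; ring_nf
  have hLap : ∀ x, lapM μ m u x = (vMeasure μ x)⁻¹ *
      ((if G.dist o x = 0 then 0 else a (G.dist o x - 1) * δ (G.dist o x - 1) ^ (m - 1)) +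
      chN N (G.dist o x) * (- (a (G.dist o x) * δ (G.dist o x) ^ (m - 1)))) := fun x => by
    unfold lapM
    rw [aux_finsum hN htree hreg o x _ (a (G.dist o x - 1) * δ (G.dist o x - 1) ^ (m - 1))
      (- (a (G.dist o x) * δ (G.dist o x) ^ (m - 1)))]
    · intro y h; simp [hμ0 x y h]
    · intro y h h'
      rw [hμ1 x y h h', hu1 x y h', mul_assoc, hδm]
    · intro y h h'
      rw [hμ2 x y h h', hu2 x y h', abs_neg, mul_neg, mul_assoc, hδm]
  have hGrad : ∀ x, gradNorm μ u x = Real.sqrt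
      ((if G.dist o x = 0 then 0 else
          a (G.dist o x - 1) / (2 * vMeasure μ x) * δ (G.dist o x - 1) ^ 2) +
      chN N (G.dist o x) * (a (G.dist o x) / (2 * vMeasure μ x) * δ (G.dist o x) ^ 2)) := fun x => by
    unfold gradNorm
    rw [aux_finsum hN htree hreg o x _ (a (G.dist o x - 1) / (2 * vMeasure μ x) * δ (G.dist o x - 1) ^ 2)
      (a (G.dist o x) / (2 * vMeasure μ x) * δ (G.dist o x) ^ 2)]
    · intro y h; simp [hμ0 x y h]
    · intro y h h'
      rw [hμ1 x y h h', hu1 x y h']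
    · intro y h h'
      rw [hμ2 x y h h', hu2 x y h', neg_sq]
  refine ⟨μ, ?_, ?_, hμ0, u, fun x => hφ _, ?_, ?_, ?_, c, C, hc, hC, ?_⟩
  · intro x y
    simp only [μ, G.adj_comm x y, min_comm (G.dist o x)]
  · intro x y
    constructor
    · intro h
      by_contra h'
      rw [hμ0 x y h'] at h
      exact lt_irrefl _ h
    · intro h
      simp only [μ, if_pos h]
      exact ha _
  · have hne : (G.neighborSet o).Nonempty := by
      apply Set.nonempty_of_ncard_ne_zero; rw [hreg]; omega
    obtain ⟨y, hy⟩ := hne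
    have hy' : G.dist o y = 1 := SimpleGraph.dist_eq_one_iff_adj.2 hy
    refine ⟨o, y, ?_⟩
    simp only [u, hy', SimpleGraph.dist_self]
    have := hφδ 0
    have := hδ 0
    simp only [zero_add] at *
    intro h; linarith
  · intro x h; linarith
  · intro x
    -- reduction to a pointwise bound on the gradient
    have red : ∀ (M X d : ℝ), 0 < M → 0 < d → vMeasure μ x = M → lapM μ m u x = M⁻¹ * X →
        gradNorm μ u x ≤ d → X + M * (u x ^ p * d ^ q) ≤ 0 →
        lapM μ m u x + u x ^ p * gradNorm μ u x ^ q ≤ 0 := by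
      intro M X d hM0 hd _ hl hgr hX
      have h1 : gradNorm μ u x ^ q ≤ d ^ q := Real.rpow_le_rpow (Real.sqrt_nonneg _) hgr hq0.le
      have h2 : 0 < u x ^ p := Real.rpow_pos_of_pos (hφ _) _
      have h3 : u x ^ p * gradNorm μ u x ^ q ≤ u x ^ p * d ^ q := mul_le_mul_of_nonneg_left h1 h2.le
      have h4 : M⁻¹ * (X + M * (u x ^ p * d ^ q)) ≤ 0 :=
        mul_nonpos_of_nonneg_of_nonpos (inv_pos.2 hM0).le hX
      rw [mul_add, inv_mul_cancel_left₀ hM0.ne'] at h4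
      rw [hl]; linarith
    have hMx := hM x
    have hLx := hLap x
    have hGx := hGrad x
    rw [hMx] at hLx hGx
    have hux : u x = φ (G.dist o x) := rfl
    rw [hux] at red ⊢
    generalize G.dist o x = n at *
    cases n with
    | zero =>
      simp only [if_true, zero_add, hca] at hMx hLx hGx
      have h0 : (sphN N 0 : ℝ) = 1 := by simp [sphN]
      rw [mul_neg, ← mul_assoc, hca, h0, div_one] at hLx
      rw [← mul_assoc, ← mul_div_assoc, hca, h0, div_one] at hGx
      rw [h0, div_one] at hMx
      refine red (w 0) _ (δ 0) (hw 0) (hδ 0) hMx hLx ?_ ?_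
      · rw [hGx]
        apply Real.sqrt_le_iff.2 ⟨(hδ 0).le, ?_⟩
        have h1 := hw 0
        have h2 : w 0 / (2 * w 0) = 1/2 := by field_simp
        rw [h2]
        nlinarith [sq_nonneg (δ 0)]
      · linarith
    | succ k =>
      simp only [Nat.succ_ne_zero, if_false, Nat.add_sub_cancel] at hMx hLx hGx
      have hak : a k = w k / sphN N (k+1) := rfl
      rw [mul_neg, ← mul_assoc, hca] at hLx
      rw [hca, ← mul_assoc, ← mul_div_assoc (chN N (k+1) : ℝ) (a (k+1)), hca] at hGx
      rw [hca] at hMx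
      have hs := hS' (k+1)
      have hw1 := hw k
      have hw2 := hw (k+1)
      have hα := ha k
      have hβ : 0 < w (k+1) / sphN N (k+1) := by positivity
      have hmx : 0 < max (δ k) (δ (k+1)) := lt_max_of_lt_left (hδ k)
      refine red (a k + w (k+1) / sphN N (k+1)) _ (max (δ k) (δ (k+1))) (by positivity) hmx hMx hLx ?_ ?_
      · rw [hGx]
        apply Real.sqrt_le_iff.2 ⟨hmx.le, ?_⟩
        have h1 : δ k ^ 2 ≤ max (δ k) (δ (k+1)) ^ 2 :=
          pow_le_pow_left₀ (hδ k).le (le_max_left _ _) 2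
        have h2 : δ (k+1) ^ 2 ≤ max (δ k) (δ (k+1)) ^ 2 :=
          pow_le_pow_left₀ (hδ (k+1)).le (le_max_right _ _) 2
        generalize max (δ k) (δ (k+1)) = d at *
        generalize w (k+1) / (sphN N (k+1) : ℝ) = β at *
        calc a k / (2 * (a k + β)) * δ k ^ 2 + β / (2 * (a k + β)) * δ (k+1) ^ 2
            ≤ a k / (2 * (a k + β)) * d ^ 2 + β / (2 * (a k + β)) * d ^ 2 := by gcongr
          _ = d ^ 2 / 2 := by field_simp
          _ ≤ d ^ 2 := by nlinarith [sq_nonneg d]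
      · have h := hstep k
        rw [hak]
        have h' : ((w k + w (k+1)) * (φ (k+1) ^ p * (max (δ k) (δ (k+1))) ^ q) -
          (w (k+1) * δ (k+1) ^ (m-1) - w k * δ k ^ (m-1))) / sphN N (k+1) ≤ 0 :=
          div_nonpos_of_nonpos_of_nonneg (by linarith) hs.le
        refine le_trans (le_of_eq ?_) h'
        field_simp
        ring
  · intro n hn
    have hW : Wvol G μ o n = ∑ k ∈ Finset.range (n+1), w k := by
      unfold Wvol
      rw [aux_ballsum hN htree hreg o n _ (fun k => w k / sphN N k)]
      · refine Finset.sum_congr rfl fun k _ => ?_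
        have := (hS' k).ne'
        field_simp
      · intro x hx
        rw [aux_finsum hN htree hreg o x _ 0 (a (G.dist o x)), hca]
        · simp
        · intro y h; simp [hμ0 x y h]
        · intro y h h'; rw [if_neg]; omega
        · intro y h h'; rw [if_pos (by omega), hμ2 x y h h']
      · intro x hx
        refine (finsum_congr (g := fun _ => 0) fun y => ?_).trans finsum_zero
        rw [if_neg]; omega
    rw [hW]
    exact hvol n hn
end
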